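/- arXiv:1209.5096 — 2 statements merged into one kernel-verified Lean document; each statement's English description precedes it below -/
import Mathlib

section
/- Let U be a nondiscrete unital subring of ℝ which either is a field or contains an ideal J ≠ U such that every element of U outside J is a unit of U. Suppose (A_t), 0 ≤ t ≤ 1, is a continuous path of positive n×n real matrices, each conjugate over ℝ to A₀, and suppose A = A₀ and B = A₁ have entries in U and are conjugate over U. Then A and B are strong shift equivalent over U₊ through positive matrices of size n. -/
open Matrix

/-- All entries of a real matrix lie in the set `S`. -/
def entriesIn {m n : ℕ} (S : Set ℝ) (A : Matrix (Fin m) (Fin n) ℝ) : Prop :=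
  ∀ i j, A i j ∈ S

/-- A matrix is positive if every entry is positive. -/
def PosEntries {m n : ℕ} (A : Matrix (Fin m) (Fin n) ℝ) : Prop :=
  ∀ i j, 0 < A i j

/-- Conjugacy over a subset `S` of `ℝ`: there is a matrix `W`, invertible with `W` and
`W⁻¹` having entries in `S`, with `W⁻¹ A W = B`. -/
def ConjOver {n : ℕ} (S : Set ℝ) (A B : Matrix (Fin n) (Fin n) ℝ) : Prop :=
  ∃ W Winv : Matrix (Fin n) (Fin n) ℝ, entriesIn S W ∧ entriesIn S Winv ∧
    W * Winv = 1 ∧ Winv * W = 1 ∧ Winv * A * W = B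

open Filter Topology

theorem LinearMap.exists_generalizedInverse {K V : Type*} [Field K] [AddCommGroup V] [Module K V]
    (T : V →ₗ[K] V) : ∃ P : V →ₗ[K] V, ∀ x, T (P (T x)) = T x := by
  obtain ⟨s, hs⟩ := T.rangeRestrict.exists_rightInverse_of_surjective T.range_rangeRestrict
  obtain ⟨P, hP⟩ := s.exists_extend
  refine ⟨P, fun x => ?_⟩
  have h1 : P (T x) = s (T.rangeRestrict x) := by
    rw [← hP]; rfl
  have h2 : T.rangeRestrict (s (T.rangeRestrict x)) = T.rangeRestrict x := LinearMap.congr_fun hs _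
  rw [h1]
  exact congrArg Subtype.val h2

/-- Elements of a conjugacy class close to `a` are conjugate to `a` by elements close to `1`. -/
theorem NormedAlgebra.eventually_exists_conj {V : Type*} [NormedRing V] [NormedAlgebra ℝ V]
    [FiniteDimensional ℝ V] (a : V) {N : Set V} (hN : N ∈ 𝓝 1) :
    ∀ᶠ b in 𝓝 a, (∃ w : Vˣ, a * w = w * b) → ∃ g ∈ N, a * g = g * b := by
  have : CompleteSpace V := FiniteDimensional.complete ℝ V
  let T (b : V) : V →ₗ[ℝ] V := LinearMap.mulLeft ℝ a - LinearMap.mulRight ℝ b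
  have hT (b x : V) : x ∈ (T b).ker ↔ a * x = x * b := by
    simp [T, LinearMap.mem_ker, sub_eq_zero]
  obtain ⟨P, hP⟩ := LinearMap.exists_generalizedInverse (T a)
  let L : V →ₗ[ℝ] V →L[ℝ] V :=
    { toFun := fun d => LinearMap.toContinuousLinearMap (P ∘ₗ LinearMap.mulRight ℝ d)
      map_add' := fun x y => by ext1 z; simp [mul_add]
      map_smul' := fun c x => by ext1 z; simp }
  let Φ : V → V →L[ℝ] V := fun b => 1 + L (a - b)
  have hΦapp (b x : V) : Φ b x = x + P (x * (a - b)) := by simp [Φ, L]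
  have hΦc : Continuous Φ := continuous_const.add
    (L.continuous_of_finiteDimensional.comp (continuous_const.sub continuous_id))
  have hΦa : Φ a = ((1 : (V →L[ℝ] V)ˣ) : V →L[ℝ] V) := by simp [Φ]
  have hunit : ∀ᶠ b in 𝓝 a, IsUnit (Φ b) := by
    refine hΦc.continuousAt.eventually (p := fun x => IsUnit x) ?_
    rw [hΦa]
    exact Units.isOpen.mem_nhds (Units.isUnit _)
  have hinv : Tendsto (fun b => Ring.inverse (Φ b) (1 : V)) (𝓝 a) (𝓝 1) := by
    have h0 := NormedRing.inverse_continuousAt (1 : (V →L[ℝ] V)ˣ)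
    rw [← hΦa] at h0
    have h1 : ContinuousAt (fun b => Ring.inverse (Φ b)) a :=
      ContinuousAt.comp (g := Ring.inverse) h0 hΦc.continuousAt
    have h2 := h1.clm_apply (continuousAt_const (y := (1 : V)))
    rw [ContinuousAt, hΦa, Ring.inverse_unit] at h2
    simpa using h2
  filter_upwards [hunit, hinv hN] with b hb hbN ⟨w, haw⟩
  refine ⟨_, hbN, ?_⟩
  obtain ⟨u, hu⟩ := hb
  have hleft (x : V) : (↑u⁻¹ : V →L[ℝ] V) (Φ b x) = x := by
    rw [← hu]
    change (↑u⁻¹ * ↑u : V →L[ℝ] V) x = x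
    simp
  have hinj : Function.Injective (Φ b) := Function.LeftInverse.injective hleft
  have hle : (T b).ker.map (Φ b : V →ₗ[ℝ] V) ≤ (T a).ker := by
    rintro _ ⟨x, hx, rfl⟩
    have e : x * (a - b) = - T a x := by
      have : a * x = x * b := (hT b x).1 hx
      simp [T, mul_sub, this]
    change T a (Φ b x) = 0
    rw [hΦapp, e, map_add, map_neg, map_neg, hP, add_neg_cancel]
  have hb' : b = ↑w⁻¹ * a * w := by rw [mul_assoc, haw, Units.inv_mul_cancel_left]
  have hfin : Module.finrank ℝ (T a).ker = Module.finrank ℝ (T b).ker := by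
    have hmap : (T a).ker.map (LinearMap.mulRight ℝ (w : V)) = (T b).ker := by
      ext x
      simp only [Submodule.mem_map, hT]
      constructor
      · rintro ⟨y, hy, rfl⟩
        simp only [LinearMap.mulRight_apply, hb', mul_assoc, Units.mul_inv_cancel_left]
        rw [← mul_assoc, hy, mul_assoc]
      · intro hx
        refine ⟨x * ↑w⁻¹, ?_, by simp⟩
        rw [← mul_assoc, hx, hb']
        simp [mul_assoc]
    rw [← hmap]
    exact (LinearEquiv.finrank_eq (Submodule.equivMapOfInjective _
      (fun x y h => by simpa using h) _))
  have heq : (T b).ker.map (Φ b : V →ₗ[ℝ] V) = (T a).ker := by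
    refine Submodule.eq_of_le_of_finrank_eq hle ?_
    rw [hfin]
    exact (LinearEquiv.finrank_eq (Submodule.equivMapOfInjective _ hinj _)).symm
  have h1 : (1 : V) ∈ (T a).ker := by simp [hT]
  rw [← heq] at h1
  obtain ⟨x, hx, hx1⟩ := h1
  have hx2 : Ring.inverse (Φ b) (1 : V) = x := by
    rw [← hx1, ← hu, Ring.inverse_unit, hu]
    exact hleft x
  change a * Ring.inverse (Φ b) (1 : V) = Ring.inverse (Φ b) (1 : V) * b
  rw [hx2]
  exact (hT b x).1 hx

attribute [local instance] Matrix.linftyOpNormedRing Matrix.linftyOpNormedAlgebra in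
theorem Matrix.eventually_exists_conj {n : ℕ} (A : Matrix (Fin n) (Fin n) ℝ)
    {N : Set (Matrix (Fin n) (Fin n) ℝ)} (hN : N ∈ 𝓝 1) :
    ∀ᶠ B in 𝓝 A, (∃ W : (Matrix (Fin n) (Fin n) ℝ)ˣ, A * W = W * B) →
      ∃ G ∈ N, A * G = G * B :=
  NormedAlgebra.eventually_exists_conj A hN

/-- Invertible real matrices which, together with their inverse, have entries in `U`. -/
def Subring.glSubgroup (U : Subring ℝ) (n : ℕ) : Subgroup (Matrix (Fin n) (Fin n) ℝ)ˣ where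
  carrier := {W | (W : Matrix (Fin n) (Fin n) ℝ) ∈ U.matrix ∧
    ((W⁻¹ : (Matrix (Fin n) (Fin n) ℝ)ˣ) : Matrix (Fin n) (Fin n) ℝ) ∈ U.matrix}
  one_mem' := ⟨one_mem _, one_mem _⟩
  mul_mem' := fun hx hy => ⟨mul_mem hx.1 hy.1, by
    rw [_root_.mul_inv_rev]; exact mul_mem hy.2 hx.2⟩
  inv_mem' := fun hx => ⟨hx.2, by rw [inv_inv]; exact hx.1⟩

theorem Subring.exists_one_add_mul_isUnit {U : Subring ℝ}
    (hU : (∀ x : U, x ≠ 0 → IsUnit x) ∨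
      ∃ J : Ideal U, J ≠ ⊤ ∧ ∀ x : U, x ∉ J → IsUnit x) :
    ∃ j : U, j ≠ 0 ∧ ∀ u : U, 1 + j * u ≠ 0 → IsUnit (1 + j * u) := by
  have of_field (h : ∀ x : U, x ≠ 0 → IsUnit x) :
      ∃ j : U, j ≠ 0 ∧ ∀ u : U, 1 + j * u ≠ 0 → IsUnit (1 + j * u) :=
    ⟨1, one_ne_zero, fun u hu => h _ hu⟩
  rcases hU with h | ⟨J, hJ, h⟩
  · exact of_field h
  by_cases hJ0 : J = ⊥
  · subst hJ0
    exact of_field fun x hx => h x hx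
  · obtain ⟨j, hj, hj0⟩ := Submodule.exists_mem_ne_zero_of_ne_bot hJ0
    refine ⟨j, hj0, fun u _ => h _ fun hmem => hJ ((Ideal.eq_top_iff_one J).2 ?_)⟩
    exact (Ideal.add_mem_iff_left J (J.mul_mem_right u hj)).1 hmem

theorem Matrix.mem_glSubgroup_of_eq_one_add_smul {U : Subring ℝ} {n : ℕ} {j : U}
    (hj : ∀ u : U, 1 + j * u ≠ 0 → IsUnit (1 + j * u)) {W : (Matrix (Fin n) (Fin n) ℝ)ˣ}
    {M : Matrix (Fin n) (Fin n) ℝ} (hM : M ∈ U.matrix)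
    (hW : (W : Matrix (Fin n) (Fin n) ℝ) = 1 + (j : ℝ) • M) : W ∈ U.glSubgroup n := by
  let M' : Matrix (Fin n) (Fin n) U := Matrix.of fun i k => ⟨M i k, hM i k⟩
  let X : Matrix (Fin n) (Fin n) U := 1 + j • M'
  have hX : U.subtype.mapMatrix X = W := by
    rw [hW, map_add, map_one]
    rfl
  have hdet : X.det ≠ 0 := by
    intro h0
    have h1 : (W : Matrix (Fin n) (Fin n) ℝ).det = 0 := by
      rw [← hX, ← RingHom.map_det, h0, map_zero]
    have h2 : IsUnit (W : Matrix (Fin n) (Fin n) ℝ).det := (Matrix.isUnit_iff_isUnit_det _).1 W.isUnit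
    exact h2.ne_zero h1
  have hunit : IsUnit X.det := by
    have h := Matrix.det_one_add_smul j M'
    have h' : X.det = 1 + j * (M'.trace + (det (1 + (Polynomial.X : Polynomial U) •
        M'.map Polynomial.C)).divX.divX.eval j * j) := by
      rw [h]; ring
    rw [h'] at hdet ⊢
    exact hj _ hdet
  have mem (Y : Matrix (Fin n) (Fin n) U) : U.subtype.mapMatrix Y ∈ U.matrix := fun i k => (Y i k).2
  obtain ⟨Y, hY⟩ := (Matrix.isUnit_iff_isUnit_det _).2 hunit
  have hYW : Units.map (U.subtype.mapMatrix : Matrix (Fin n) (Fin n) U →+* _).toMonoidHom Y = W := by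
    ext1
    rw [← hX, ← hY]; rfl
  rw [← hYW]
  exact ⟨mem _, by rw [← map_inv]; exact mem _⟩

theorem Subring.exists_smul_mem_matrix {U : Subring ℝ} {n : ℕ} {M : Matrix (Fin n) (Fin n) ℝ}
    (hM : ∀ i k, M i k ∈ Subfield.closure (U : Set ℝ)) :
    ∃ d : ℝ, d ∈ U ∧ d ≠ 0 ∧ d • M ∈ U.matrix := by
  have h (p : Fin n × Fin n) : ∃ z ∈ U, z ≠ 0 ∧ z * M p.1 p.2 ∈ U := by
    obtain ⟨y, hy, z, hz, hyz⟩ := Subfield.mem_closure_iff.1 (hM p.1 p.2)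
    rw [Subring.closure_eq] at hy hz
    by_cases hz0 : z = 0
    · exact ⟨1, one_mem _, one_ne_zero, by simp [← hyz, hz0]⟩
    · exact ⟨z, hz, hz0, by rwa [← hyz, mul_div_cancel₀ _ hz0]⟩
  choose z hz hz0 hzM using h
  refine ⟨∏ p, z p, prod_mem fun p _ => hz p, Finset.prod_ne_zero_iff.2 fun p _ => hz0 p,
    fun i k => ?_⟩
  rw [Matrix.smul_apply, smul_eq_mul, ← Finset.prod_erase_mul _ _ (Finset.mem_univ (i, k)),
    mul_assoc]
  exact U.mul_mem (prod_mem fun p _ => hz p) (hzM (i, k))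

/-- The centralizer of a matrix over `U` has a dense set of points over any nonzero principal
ideal of `U`. -/
theorem Matrix.mem_closure_smul_commute {U : Subring ℝ} (hU : Dense (U : Set ℝ)) {n : ℕ} {j : ℝ}
    (hj0 : j ≠ 0) {B M : Matrix (Fin n) (Fin n) ℝ} (hB : B ∈ U.matrix)
    (hM : Commute M B) :
    M ∈ closure {X | ∃ Y ∈ U.matrix, Commute Y B ∧ X = j • Y} := by
  let Λ : AddSubgroup (Matrix (Fin n) (Fin n) ℝ) :=
    { carrier := {X | ∃ Y ∈ U.matrix, Commute Y B ∧ X = j • Y}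
      zero_mem' := ⟨0, zero_mem _, Commute.zero_left _, by simp⟩
      add_mem' := by
        rintro _ _ ⟨Y, hY, hYB, rfl⟩ ⟨Y', hY', hYB', rfl⟩
        exact ⟨Y + Y', add_mem hY hY', hYB.add_left hYB', (smul_add _ _ _).symm⟩
      neg_mem' := by
        rintro _ ⟨Y, hY, hYB, rfl⟩
        exact ⟨-Y, neg_mem hY, hYB.neg_left, (smul_neg _ _).symm⟩ }
  change M ∈ Λ.topologicalClosure
  have hsmul (r : ℝ) {X : Matrix (Fin n) (Fin n) ℝ} (hX : X ∈ Λ.topologicalClosure) :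
      r • X ∈ Λ.topologicalClosure := by
    refine map_mem_closure₂ (f := fun (r : ℝ) (X : Matrix (Fin n) (Fin n) ℝ) => r • X)
      continuous_smul (hU r) hX ?_
    rintro u hu _ ⟨Y, hY, hYB, rfl⟩
    exact ⟨u • Y, fun i k => U.mul_mem hu (hY i k), hYB.smul_left u, smul_comm _ _ _⟩
  let F := Subfield.closure (U : Set ℝ)
  have hUF {x : ℝ} (hx : x ∈ U) : x ∈ F := Subfield.subset_closure hx
  let b := Module.Basis.ofVectorSpace F ℝ
  let c (i) (X : Matrix (Fin n) (Fin n) ℝ) : Matrix (Fin n) (Fin n) ℝ :=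
    X.map fun x => (b.repr x i : ℝ)
  have hrepr (i) (f : Fin n → ℝ) (g : Fin n → F) :
      (b.repr (∑ k, f k * g k) i : ℝ) = ∑ k, (b.repr (f k) i : ℝ) * g k := by
    have : ∑ k, f k * (g k : ℝ) = ∑ k, g k • f k :=
      Finset.sum_congr rfl fun k _ => mul_comm _ _
    rw [this, map_sum, Finsupp.finsetSum_apply]
    push_cast
    refine Finset.sum_congr rfl fun k _ => ?_
    rw [map_smul, Finsupp.smul_apply, smul_eq_mul]
    push_cast
    exact mul_comm _ _
  have hcB (i) : Commute (c i M) B := by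
    let B' (k l : Fin n) : F := ⟨B k l, hUF (hB k l)⟩
    ext k l
    have h1 : (M * B) k l = (B * M) k l := by rw [hM.eq]
    rw [Matrix.mul_apply, Matrix.mul_apply] at h1 ⊢
    have h2 := hrepr i (fun m => M k m) fun m => B' m l
    have h3 := hrepr i (fun m => M m l) fun m => B' k m
    simp only [c, Matrix.map_apply]
    calc _ = _ := h2.symm
      _ = _ := by
        congr 3
        rw [h1]
        exact Finset.sum_congr rfl fun m _ => mul_comm _ _
      _ = _ := h3
      _ = _ := Finset.sum_congr rfl fun m _ => mul_comm _ _
  have hcmem (i) : c i M ∈ Λ.topologicalClosure := by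
    obtain ⟨d, hd, hd0, hdM⟩ := Subring.exists_smul_mem_matrix (U := U) (M := c i M)
      fun k l => (b.repr (M k l) i).2
    have h1 : j • d • c i M ∈ Λ := ⟨d • c i M, hdM, (hcB i).smul_left d, rfl⟩
    have h2 := hsmul (j * d)⁻¹ (Λ.le_topologicalClosure h1)
    rwa [smul_smul j d, inv_smul_smul₀ (mul_ne_zero hj0 hd0)] at h2
  classical
  let s := Finset.univ.biUnion fun p : Fin n × Fin n => (b.repr (M p.1 p.2)).support
  have hsum : M = ∑ i ∈ s, b i • c i M := by
    ext k l
    rw [Matrix.sum_apply]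
    conv_lhs => rw [← b.linearCombination_repr (M k l), Finsupp.linearCombination_apply]
    rw [Finsupp.sum_of_support_subset (s := s) _ _ _ (by simp)]
    · exact Finset.sum_congr rfl fun i _ => mul_comm _ _
    · exact Finset.subset_biUnion_of_mem
        (fun p : Fin n × Fin n => (b.repr (M p.1 p.2)).support) (Finset.mem_univ (k, l))
  rw [hsum]
  exact sum_mem fun i _ => hsmul _ (hcmem i)

attribute [local instance] Matrix.linftyOpNormedRing Matrix.linftyOpNormedAlgebra in
theorem Matrix.isOpenEmbedding_units_val (n : ℕ) :
    IsOpenEmbedding (Units.val : (Matrix (Fin n) (Fin n) ℝ)ˣ → Matrix (Fin n) (Fin n) ℝ) :=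
  have : CompleteSpace (Matrix (Fin n) (Fin n) ℝ) := FiniteDimensional.complete ℝ _
  Units.isOpenEmbedding_val

theorem Matrix.exists_mem_glSubgroup_commute {U : Subring ℝ} (hU : Dense (U : Set ℝ)) {n : ℕ}
    {j : U} (hj0 : j ≠ 0) (hj : ∀ u : U, 1 + j * u ≠ 0 → IsUnit (1 + j * u))
    {B : Matrix (Fin n) (Fin n) ℝ} (hB : B ∈ U.matrix) {Z : (Matrix (Fin n) (Fin n) ℝ)ˣ}
    (hZ : Commute (Z : Matrix (Fin n) (Fin n) ℝ) B) :
    ∃ᶠ V in 𝓝 Z, V ∈ U.glSubgroup n ∧ Commute (V : Matrix (Fin n) (Fin n) ℝ) B := by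
  rw [frequently_iff]
  intro N hN
  have hN' := (Matrix.isOpenEmbedding_units_val n).image_mem_nhds.2 hN
  have hcl := Matrix.mem_closure_smul_commute hU (j := j) (by simpa using hj0) hB
    (hZ.sub_left (Commute.one_left B))
  have hcont : Tendsto (fun X : Matrix (Fin n) (Fin n) ℝ => 1 + X)
      (𝓝 ((Z : Matrix (Fin n) (Fin n) ℝ) - 1)) (𝓝 Z) := by
    have : Continuous fun X : Matrix (Fin n) (Fin n) ℝ => 1 + X := by fun_prop
    simpa using this.tendsto ((Z : Matrix (Fin n) (Fin n) ℝ) - 1)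
  obtain ⟨_, ⟨V, hVN, hV⟩, Y, hY, hYB, rfl⟩ := mem_closure_iff_nhds.1 hcl _ (hcont hN')
  exact ⟨V, hVN, Matrix.mem_glSubgroup_of_eq_one_add_smul hj hY hV,
    hV ▸ (Commute.one_left B).add_left (hYB.smul_left _)⟩

theorem isOpen_posEntries (m n : ℕ) : IsOpen {X : Matrix (Fin m) (Fin n) ℝ | PosEntries X} := by
  have : {X : Matrix (Fin m) (Fin n) ℝ | PosEntries X} = ⋂ i, ⋂ j, {X | 0 < X i j} := by
    ext X; simp [PosEntries]
  rw [this]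
  exact isOpen_iInter_of_finite fun i => isOpen_iInter_of_finite fun j =>
    isOpen_lt continuous_const (continuous_id.matrix_elem i j)

/-- Elementary strong shift equivalence over `U₊` of positive matrices of size `n`. -/
def PosESSE (U : Subring ℝ) {n : ℕ} (X Y : Matrix (Fin n) (Fin n) ℝ) : Prop :=
  PosEntries X ∧ PosEntries Y ∧
    ∃ R S : Matrix (Fin n) (Fin n) ℝ,
      entriesIn {x : ℝ | x ∈ U ∧ 0 ≤ x} R ∧ entriesIn {x : ℝ | x ∈ U ∧ 0 ≤ x} S ∧
      X = R * S ∧ Y = S * R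

theorem PosESSE.symm {U : Subring ℝ} {n : ℕ} {X Y : Matrix (Fin n) (Fin n) ℝ}
    (h : PosESSE U X Y) : PosESSE U Y X :=
  let ⟨hX, hY, R, S, hR, hS, hXRS, hYSR⟩ := h
  ⟨hY, hX, S, R, hS, hR, hYSR, hXRS⟩

/-- The conjugate `X⁻¹ A X`. -/
def Matrix.conjBy {n : ℕ} (A : Matrix (Fin n) (Fin n) ℝ) (X : (Matrix (Fin n) (Fin n) ℝ)ˣ) :
    Matrix (Fin n) (Fin n) ℝ :=
  X⁻¹.val * A * X.val

theorem Matrix.conjBy_mul_of_commute {n : ℕ} {A : Matrix (Fin n) (Fin n) ℝ}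
    {Z : (Matrix (Fin n) (Fin n) ℝ)ˣ} (hZ : Commute (Z : Matrix (Fin n) (Fin n) ℝ) A)
    (X : (Matrix (Fin n) (Fin n) ℝ)ˣ) : A.conjBy (Z * X) = A.conjBy X := by
  have h : Z⁻¹.val * (A * Z.val) = A := by rw [← hZ.eq, Units.inv_mul_cancel_left]
  simp only [Matrix.conjBy, _root_.mul_inv_rev, Units.val_mul]
  calc _ = X⁻¹.val * (Z⁻¹.val * (A * Z.val)) * X.val := by simp only [mul_assoc]
    _ = _ := by rw [h]

theorem Matrix.continuous_conjBy {n : ℕ} (A : Matrix (Fin n) (Fin n) ℝ) :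
    Continuous A.conjBy :=
  ((Units.continuous_val.comp continuous_inv).mul continuous_const).mul Units.continuous_val

theorem PosESSE.conjBy {U : Subring ℝ} {n : ℕ} {A : Matrix (Fin n) (Fin n) ℝ}
    (hA : A ∈ U.matrix) {X Y : (Matrix (Fin n) (Fin n) ℝ)ˣ} (hX : X ∈ U.glSubgroup n)
    (hY : Y ∈ U.glSubgroup n) (hAX : PosEntries (A.conjBy X)) (hAY : PosEntries (A.conjBy Y))
    (hR : PosEntries (X⁻¹.val * Y.val))
    (hS : PosEntries (Y⁻¹.val * A * X.val)) :
    PosESSE U (A.conjBy X) (A.conjBy Y) := by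
  have hRU : (X⁻¹.val * Y.val) ∈ U.matrix := mul_mem hX.2 hY.1
  have hSU : (Y⁻¹.val * A * X.val) ∈ U.matrix :=
    mul_mem (mul_mem hY.2 hA) hX.1
  exact ⟨hAX, hAY, _, _, fun i j => ⟨hRU i j, (hR i j).le⟩, fun i j => ⟨hSU i j, (hS i j).le⟩,
    by simp [Matrix.conjBy, mul_assoc], by simp [Matrix.conjBy, mul_assoc]⟩

/-- There are positive matrices in `GL(n, U)` arbitrarily close to `1`. -/
theorem Matrix.frequently_posEntries_mem_glSubgroup {U : Subring ℝ} (hU : Dense (U : Set ℝ))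
    {n : ℕ} {j : U} (hj0 : j ≠ 0) (hj : ∀ u : U, 1 + j * u ≠ 0 → IsUnit (1 + j * u)) :
    ∃ᶠ V in 𝓝 (1 : (Matrix (Fin n) (Fin n) ℝ)ˣ),
      V ∈ U.glSubgroup n ∧ PosEntries (V : Matrix (Fin n) (Fin n) ℝ) := by
  rw [frequently_iff]
  intro N hN
  obtain ⟨O, hON, hO, h1O⟩ := mem_nhds_iff.1 hN
  have hO' := (Matrix.isOpenEmbedding_units_val n).image_mem_nhds.2 (hO.mem_nhds h1O)
  let f : ℝ → Matrix (Fin n) (Fin n) ℝ := fun ε => 1 + ε • Matrix.of fun _ _ => 1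
  have hf : Tendsto f (𝓝[>] 0) (𝓝 ((1 : (Matrix (Fin n) (Fin n) ℝ)ˣ) :
      Matrix (Fin n) (Fin n) ℝ)) := by
    have : Continuous f := by fun_prop
    simpa [f] using (this.tendsto 0).mono_left nhdsWithin_le_nhds
  obtain ⟨ε, ⟨Z, hZO, hZ⟩, hε⟩ := ((hf.eventually hO').and self_mem_nhdsWithin).exists
  have hZpos : PosEntries (Z : Matrix (Fin n) (Fin n) ℝ) := by
    intro i k
    have hε' : 0 < ε := hε
    have : (0 : ℝ) ≤ (1 : Matrix (Fin n) (Fin n) ℝ) i k := by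
      rw [Matrix.one_apply]; split_ifs <;> norm_num
    rw [hZ]
    simp only [f, Matrix.add_apply, Matrix.smul_apply, Matrix.of_apply, smul_eq_mul, mul_one]
    positivity
  have hpos : ∀ᶠ V : (Matrix (Fin n) (Fin n) ℝ)ˣ in 𝓝 Z,
      PosEntries (V : Matrix (Fin n) (Fin n) ℝ) :=
    Units.continuous_val.continuousAt.eventually ((isOpen_posEntries n n).mem_nhds hZpos)
  obtain ⟨V, ⟨hVU, -⟩, hV, hVO⟩ := ((Matrix.exists_mem_glSubgroup_commute hU hj0 hj
    (one_mem U.matrix) (Commute.one_right (Z : Matrix (Fin n) (Fin n) ℝ))).and_eventually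
      (hpos.and (hO.mem_nhds hZO))).exists
  exact ⟨V, hON hVO, hVU, hV⟩

theorem Matrix.eventually_reflTransGen_posESSE_conjBy {U : Subring ℝ} (hU : Dense (U : Set ℝ))
    {n : ℕ} {j : U} (hj0 : j ≠ 0) (hj : ∀ u : U, 1 + j * u ≠ 0 → IsUnit (1 + j * u))
    {A : Matrix (Fin n) (Fin n) ℝ} (hA : A ∈ U.matrix) {G : (Matrix (Fin n) (Fin n) ℝ)ˣ}
    (hG : PosEntries (A.conjBy G)) :
    ∀ᶠ p in 𝓝 (G, G), p.1 ∈ U.glSubgroup n → p.2 ∈ U.glSubgroup n →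
      Relation.ReflTransGen (PosESSE U) (A.conjBy p.1) (A.conjBy p.2) := by
  have hpos {X : Type} [TopologicalSpace X] {f : X → Matrix (Fin n) (Fin n) ℝ} {x : X}
      (hf : Continuous f) (hx : PosEntries (f x)) : ∀ᶠ y in 𝓝 x, PosEntries (f y) :=
    hf.continuousAt.eventually ((isOpen_posEntries n n).mem_nhds hx)
  have hval := Units.continuous_val (M := Matrix (Fin n) (Fin n) ℝ)
  have hQ1 : ∀ᶠ Q in 𝓝 (1 : (Matrix (Fin n) (Fin n) ℝ)ˣ), PosEntries (A.conjBy (G * Q)) :=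
    hpos (A.continuous_conjBy.comp (continuous_const.mul continuous_id)) (by simpa using hG)
  have hQ2 : ∀ᶠ Q in 𝓝 (1 : (Matrix (Fin n) (Fin n) ℝ)ˣ),
      PosEntries ((G * Q)⁻¹.val * A * G.val) :=
    hpos (((hval.comp (continuous_const.mul continuous_id).inv).mul continuous_const).mul
      continuous_const) (by simpa [Matrix.conjBy] using hG)
  obtain ⟨Q, ⟨hQU, hQpos⟩, hQ1, hQ2⟩ :=
    ((Matrix.frequently_posEntries_mem_glSubgroup hU hj0 hj).and_eventually (hQ1.and hQ2)).exists
  have hstep : ∀ᶠ p in 𝓝 (G, G), p.1 ∈ U.glSubgroup n → p.2 ∈ U.glSubgroup n →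
      PosESSE U (A.conjBy p.1) (A.conjBy (p.2 * Q)) := by
    have h1 : ∀ᶠ p in 𝓝 (G, G), PosEntries (A.conjBy p.1) :=
      hpos (A.continuous_conjBy.comp continuous_fst) hG
    have h2 : ∀ᶠ p in 𝓝 (G, G), PosEntries (A.conjBy (p.2 * Q)) :=
      hpos (A.continuous_conjBy.comp (continuous_snd.mul continuous_const)) hQ1
    have h3 : ∀ᶠ p in 𝓝 (G, G), PosEntries (p.1⁻¹.val * (p.2 * Q).val) :=
      hpos ((hval.comp continuous_fst.inv).mul (hval.comp (continuous_snd.mul continuous_const)))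
        (by simpa using hQpos)
    have h4 : ∀ᶠ p in 𝓝 (G, G), PosEntries ((p.2 * Q)⁻¹.val * A * p.1.val) :=
      hpos (((hval.comp (continuous_snd.mul continuous_const).inv).mul continuous_const).mul
        (hval.comp continuous_fst)) hQ2
    filter_upwards [h1, h2, h3, h4] with p h1 h2 h3 h4 hX hY
    exact PosESSE.conjBy hA hX (mul_mem hY hQU) h1 h2 h3 h4
  have hdiag : Tendsto (fun p : (Matrix (Fin n) (Fin n) ℝ)ˣ × (Matrix (Fin n) (Fin n) ℝ)ˣ =>
      (p.2, p.2)) (𝓝 (G, G)) (𝓝 (G, G)) :=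
    (continuous_snd.prodMk continuous_snd).tendsto (G, G)
  filter_upwards [hstep, hdiag.eventually hstep] with p hp hp' hX hY
  exact .tail (.single (hp hX hY)) (hp' hY hY).symm

/-- Conjugates of `A` by elements of `GL(n, U)` close to `G` are reachable from `A`. -/
def Matrix.ReachableNear (U : Subring ℝ) {n : ℕ} (A : Matrix (Fin n) (Fin n) ℝ)
    (G : (Matrix (Fin n) (Fin n) ℝ)ˣ) : Prop :=
  ∃ᶠ X in 𝓝 G, X ∈ U.glSubgroup n ∧ Relation.ReflTransGen (PosESSE U) A (A.conjBy X)

theorem Matrix.ReachableNear.mul_left {U : Subring ℝ} (hU : Dense (U : Set ℝ))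
    {n : ℕ} {j : U} (hj0 : j ≠ 0) (hj : ∀ u : U, 1 + j * u ≠ 0 → IsUnit (1 + j * u))
    {A : Matrix (Fin n) (Fin n) ℝ} (hA : A ∈ U.matrix) {Z G : (Matrix (Fin n) (Fin n) ℝ)ˣ}
    (hZ : Commute (Z : Matrix (Fin n) (Fin n) ℝ) A) (hG : A.ReachableNear U G) :
    A.ReachableNear U (Z * G) := by
  refine frequently_iff.2 fun {N} hN => ?_
  have hmul := (continuous_mul.tendsto (Z, G)) hN
  rw [nhds_prod_eq] at hmul
  obtain ⟨S, hS, T, hT, hST⟩ := mem_prod_iff.1 hmul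
  obtain ⟨V, hVS, hVU, hV⟩ :=
    frequently_iff.1 (Matrix.exists_mem_glSubgroup_commute hU hj0 hj hA hZ) hS
  obtain ⟨X, hXT, hXU, hX⟩ := frequently_iff.1 hG hT
  exact ⟨V * X, hST (Set.mk_mem_prod hVS hXT), mul_mem hVU hXU,
    by rwa [Matrix.conjBy_mul_of_commute hV]⟩

theorem Matrix.ReachableNear.of_conjBy_eq {U : Subring ℝ} (hU : Dense (U : Set ℝ))
    {n : ℕ} {j : U} (hj0 : j ≠ 0) (hj : ∀ u : U, 1 + j * u ≠ 0 → IsUnit (1 + j * u))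
    {A : Matrix (Fin n) (Fin n) ℝ} (hA : A ∈ U.matrix) {G G' : (Matrix (Fin n) (Fin n) ℝ)ˣ}
    (h : A.conjBy G = A.conjBy G') (hG : A.ReachableNear U G) : A.ReachableNear U G' := by
  have hZ : Commute ((G' * G⁻¹ : (Matrix (Fin n) (Fin n) ℝ)ˣ) : Matrix (Fin n) (Fin n) ℝ) A := by
    have h' := congrArg (fun M : Matrix (Fin n) (Fin n) ℝ => G'.val * M * G⁻¹.val) h
    simpa [Matrix.conjBy, mul_assoc, Commute, SemiconjBy] using h'
  simpa using hG.mul_left hU hj0 hj hA hZ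

theorem Matrix.eventually_reachableNear_iff {U : Subring ℝ} (hU : Dense (U : Set ℝ))
    {n : ℕ} {j : U} (hj0 : j ≠ 0) (hj : ∀ u : U, 1 + j * u ≠ 0 → IsUnit (1 + j * u))
    {A : Matrix (Fin n) (Fin n) ℝ} (hA : A ∈ U.matrix) {G : (Matrix (Fin n) (Fin n) ℝ)ˣ}
    (hG : PosEntries (A.conjBy G)) :
    ∀ᶠ G' in 𝓝 G, A.ReachableNear U G' ↔ A.ReachableNear U G := by
  have h := Matrix.eventually_reflTransGen_posESSE_conjBy hU hj0 hj hA hG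
  rw [nhds_prod_eq] at h
  obtain ⟨N, hN, h⟩ := mem_prod_self_iff.1 h
  obtain ⟨O, hON, hO, hGO⟩ := mem_nhds_iff.1 hN
  have key {G₁ G₂ : (Matrix (Fin n) (Fin n) ℝ)ˣ} (h₁ : G₁ ∈ O) (h₂ : G₂ ∈ O)
      (hr : A.ReachableNear U G₁) : A.ReachableNear U G₂ := by
    obtain ⟨X, hXO, hXU, hX⟩ := frequently_iff.1 hr (hO.mem_nhds h₁)
    have hd := Matrix.exists_mem_glSubgroup_commute hU hj0 hj (one_mem U.matrix)
      (Commute.one_right (G₂ : Matrix (Fin n) (Fin n) ℝ))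
    refine (hd.and_eventually (hO.mem_nhds h₂)).mono ?_
    rintro Y ⟨⟨hYU, -⟩, hYO⟩
    exact ⟨hYU, hX.trans (h (Set.mk_mem_prod (hON hXO) (hON hYO)) hXU hYU)⟩
  filter_upwards [hO.mem_nhds hGO] with G' hG'
  exact ⟨key hG' hGO, key hGO hG'⟩

theorem Matrix.ReachableNear.reflTransGen {U : Subring ℝ} (hU : Dense (U : Set ℝ))
    {n : ℕ} {j : U} (hj0 : j ≠ 0) (hj : ∀ u : U, 1 + j * u ≠ 0 → IsUnit (1 + j * u))
    {A : Matrix (Fin n) (Fin n) ℝ} (hA : A ∈ U.matrix) {W : (Matrix (Fin n) (Fin n) ℝ)ˣ}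
    (hWU : W ∈ U.glSubgroup n) (hW : PosEntries (A.conjBy W)) (hr : A.ReachableNear U W) :
    Relation.ReflTransGen (PosESSE U) A (A.conjBy W) := by
  have h := (Matrix.eventually_reflTransGen_posESSE_conjBy hU hj0 hj hA hW).curry_nhds
  obtain ⟨X, ⟨hXU, hX⟩, hXW⟩ := (hr.and_eventually h).exists
  exact hX.trans (hXW.self_of_nhds hXU hWU)

/-- Path Theorem, part (4): if `U` is a nondiscrete unital subring of `ℝ` which is a
field or has a proper ideal `J` with every element outside `J` a unit, and `A₀, A₁`
are endpoints of a continuous path of positive conjugate `n × n` real matrices which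
are moreover over `U` and conjugate over `U`, then `A₀` and `A₁` are strong shift
equivalent over `U₊` through positive matrices of size `n`. -/
theorem path_theorem_over_U (U : Subring ℝ) (hU : Dense (U : Set ℝ))
    (hUfield : (∀ x : U, x ≠ 0 → IsUnit x) ∨
      (∃ J : Ideal U, J ≠ ⊤ ∧ ∀ x : U, x ∉ J → IsUnit x))
    (n : ℕ) (A : ℝ → Matrix (Fin n) (Fin n) ℝ)
    (hcont : ContinuousOn A (Set.Icc 0 1))
    (hpos : ∀ t ∈ Set.Icc (0 : ℝ) 1, PosEntries (A t))
    (hconjR : ∀ t ∈ Set.Icc (0 : ℝ) 1, ∃ G Ginv : Matrix (Fin n) (Fin n) ℝ,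
      G * Ginv = 1 ∧ Ginv * G = 1 ∧ A t = Ginv * A 0 * G)
    (hA0U : entriesIn (U : Set ℝ) (A 0)) (hA1U : entriesIn (U : Set ℝ) (A 1))
    (hconjU : ConjOver (U : Set ℝ) (A 0) (A 1)) :
    Relation.ReflTransGen
      (fun X Y : Matrix (Fin n) (Fin n) ℝ =>
        PosEntries X ∧ PosEntries Y ∧
        ∃ R S : Matrix (Fin n) (Fin n) ℝ,
          entriesIn {x : ℝ | x ∈ U ∧ 0 ≤ x} R ∧ entriesIn {x : ℝ | x ∈ U ∧ 0 ≤ x} S ∧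
          X = R * S ∧ Y = S * R)
      (A 0) (A 1) := by
  change Relation.ReflTransGen (PosESSE U) (A 0) (A 1)
  obtain ⟨j, hj0, hj⟩ := Subring.exists_one_add_mul_isUnit hUfield
  have hA : A 0 ∈ U.matrix := hA0U
  have hconj : ∀ t ∈ Set.Icc (0 : ℝ) 1, ∃ G : (Matrix (Fin n) (Fin n) ℝ)ˣ,
      (A 0).conjBy G = A t := fun t ht =>
    let ⟨G, Ginv, h1, h2, h3⟩ := hconjR t ht
    ⟨⟨G, Ginv, h1, h2⟩, h3.symm⟩
  let T (t : ℝ) : Prop := ∀ G, (A 0).conjBy G = A t → (A 0).ReachableNear U G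
  have hT {t : ℝ} {G : (Matrix (Fin n) (Fin n) ℝ)ˣ} (hG : (A 0).conjBy G = A t) :
      T t ↔ (A 0).ReachableNear U G :=
    ⟨fun h => h G hG, fun h G' hG' => h.of_conjBy_eq hU hj0 hj hA (hG.trans hG'.symm)⟩
  have hloc : ∀ t ∈ Set.Icc (0 : ℝ) 1, ∀ᶠ s in 𝓝[Set.Icc 0 1] t, (T s ↔ T t) := by
    intro t ht
    obtain ⟨G, hG⟩ := hconj t ht
    have hmul : Tendsto (fun g => G * g) (𝓝 1) (𝓝 G) := by
      simpa using (continuous_const_mul G).tendsto 1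
    have hnear := hmul.eventually
      (Matrix.eventually_reachableNear_iff hU hj0 hj hA (G := G) (hG ▸ hpos t ht))
    have horb := Matrix.eventually_exists_conj (A t)
      ((Matrix.isOpenEmbedding_units_val n).image_mem_nhds.2 hnear)
    filter_upwards [(hcont t ht).eventually horb, self_mem_nhdsWithin] with s hs hsI
    obtain ⟨G', hG'⟩ := hconj s hsI
    obtain ⟨_, ⟨g, hg, rfl⟩, hgA⟩ := hs ⟨G⁻¹ * G', by
      rw [← hG, ← hG']
      simp [Matrix.conjBy, mul_assoc]⟩
    have hGg : (A 0).conjBy (G * g) = A s := by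
      have h : (A 0).conjBy (G * g) = g⁻¹.val * (A t * g.val) := by
        rw [← hG]
        simp [Matrix.conjBy, mul_assoc]
      rw [h, hgA, Units.inv_mul_cancel_left]
    rw [hT hG, hT hGg]
    exact hg
  have h01 : T 0 → T 1 :=
    isPreconnected_Icc.induction₂' (fun s t => T s → T t)
      (fun t ht => (hloc t ht).mono fun s hs => ⟨hs.2, hs.1⟩)
      (fun _ _ _ _ _ _ h h' => h' ∘ h) (Set.left_mem_Icc.2 zero_le_one)
      (Set.right_mem_Icc.2 zero_le_one)
  have hone : (A 0).conjBy 1 = A 0 := by simp [Matrix.conjBy]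
  have h0 : T 0 := (hT hone).2 <| frequently_iff.2 fun hN =>
    ⟨1, mem_of_mem_nhds hN, one_mem _, by rw [hone]⟩
  obtain ⟨W, Winv, hW, hWinv, h1, h2, h3⟩ := hconjU
  have hWA : (A 0).conjBy ⟨W, Winv, h1, h2⟩ = A 1 := h3
  rw [← hWA]
  exact Matrix.ReachableNear.reflTransGen hU hj0 hj hA ⟨hW, hWinv⟩
    (hWA ▸ hpos 1 (Set.right_mem_Icc.2 zero_le_one)) (h01 h0 _ hWA)
end

section
/- Let A be a positive n×n real matrix. Then the set of positive n×n matrices conjugate over ℝ to A contains only finitely many strong-shift-equivalence-over-ℝ₊ classes: there exists a finite set F of positive n×n matrices such that every positive n×n matrix conjugate over ℝ to A is strong shift equivalent over ℝ₊ to some member of F. -/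
open Matrix

/-- Elementary strong shift equivalence over `S` between square real matrices
(of possibly different sizes). -/
def ESSE (S : Set ℝ) (p q : (n : ℕ) × Matrix (Fin n) (Fin n) ℝ) : Prop :=
  ∃ (R : Matrix (Fin p.1) (Fin q.1) ℝ) (S' : Matrix (Fin q.1) (Fin p.1) ℝ),
    entriesIn S R ∧ entriesIn S S' ∧ p.2 = R * S' ∧ q.2 = S' * R

/-- Strong shift equivalence over `S`: a finite chain of elementary strong shift
equivalences. -/
def SSE (S : Set ℝ) : ((n : ℕ) × Matrix (Fin n) (Fin n) ℝ) →
    ((n : ℕ) × Matrix (Fin n) (Fin n) ℝ) → Prop :=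
  Relation.ReflTransGen (ESSE S)

open MvPolynomial Filter Topology

theorem MvPolynomial.hasFDerivAt_eval {σ : Type*} [Fintype σ] (p : MvPolynomial σ ℝ) (x : σ → ℝ) :
    HasFDerivAt (fun y => eval y p)
      (∑ j, eval x (pderiv j p) • ContinuousLinearMap.proj (R := ℝ) (φ := fun _ : σ => ℝ) j) x := by
  classical
  induction p using MvPolynomial.induction_on with
  | C a => simpa using hasFDerivAt_const a x
  | add p q hp hq =>
    refine ((hp.add hq).congr_fderiv ?_).congr_of_eventuallyEq (.of_forall fun y => map_add _ p q)
    simp [add_smul, Finset.sum_add_distrib]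
  | mul_X p i hp =>
    have h := hp.mul (hasFDerivAt_apply (𝕜 := ℝ) i x)
    refine (h.congr_fderiv ?_).congr_of_eventuallyEq (.of_forall fun y => by simp)
    ext v
    simp [pderiv_X, Pi.single_apply, add_mul, Finset.sum_add_distrib, Finset.mul_sum, apply_ite,
      ite_mul, mul_assoc]

theorem MvPolynomial.abs_eval_le_exp {σ : Type*} [Fintype σ] (p : MvPolynomial σ ℝ) :
    ∃ M k : ℝ, 0 ≤ k ∧ ∀ x : σ → ℝ, |eval x p| ≤ M * Real.exp (k * ∑ i, |x i|) := by
  induction p using MvPolynomial.induction_on with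
  | C a => exact ⟨|a|, 0, le_rfl, fun x => by simp⟩
  | add p q hp hq =>
    obtain ⟨M, k, hk, h⟩ := hp
    obtain ⟨N, l, hl, h'⟩ := hq
    refine ⟨|M| + |N|, k + l, by positivity, fun x => ?_⟩
    have hs : 0 ≤ ∑ i, |x i| := by positivity
    have e1 : Real.exp (k * ∑ i, |x i|) ≤ Real.exp ((k + l) * ∑ i, |x i|) :=
      Real.exp_le_exp.2 (by nlinarith)
    have e2 : Real.exp (l * ∑ i, |x i|) ≤ Real.exp ((k + l) * ∑ i, |x i|) :=
      Real.exp_le_exp.2 (by nlinarith)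
    calc |eval x (p + q)| ≤ |eval x p| + |eval x q| := by rw [map_add]; exact abs_add_le _ _
      _ ≤ M * Real.exp (k * ∑ i, |x i|) + N * Real.exp (l * ∑ i, |x i|) := add_le_add (h x) (h' x)
      _ ≤ |M| * Real.exp (k * ∑ i, |x i|) + |N| * Real.exp (l * ∑ i, |x i|) := by
        gcongr <;> exact le_abs_self _
      _ ≤ _ := by rw [add_mul]; gcongr
  | mul_X p i hp =>
    obtain ⟨M, k, hk, h⟩ := hp
    refine ⟨M, k + 1, by positivity, fun x => ?_⟩
    have hi : |x i| ≤ Real.exp (∑ i, |x i|) :=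
      calc |x i| ≤ ∑ i, |x i| := Finset.single_le_sum (f := fun i => |x i|) (fun _ _ => abs_nonneg _)
            (Finset.mem_univ i)
        _ ≤ (∑ i, |x i|) + 1 := by linarith
        _ ≤ _ := Real.add_one_le_exp _
    rw [map_mul, eval_X, abs_mul, add_mul, Real.exp_add, one_mul, ← mul_assoc]
    exact mul_le_mul (h x) hi (abs_nonneg _) ((abs_nonneg _).trans (h x))

/-- Superlevel sets of a Gaussian-damped polynomial are bounded. -/
theorem MvPolynomial.isBounded_le_eval_mul_exp {σ : Type*} [Fintype σ] (p : MvPolynomial σ ℝ)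
    (a : σ → ℝ) {c : ℝ} (hc : 0 < c) :
    Bornology.IsBounded {x : σ → ℝ | c ≤ eval x p * Real.exp (-∑ i, (x i ^ 2 / 2 + a i * x i))} := by
  obtain ⟨M, k, hk, h⟩ := p.abs_eval_le_exp
  set A : ℝ := ∑ i, |a i|
  set B : ℝ := Real.log (M / c) + ∑ _i : σ, (k + A) ^ 2
  refine (Metric.isBounded_closedBall (x := (0 : σ → ℝ)) (r := Real.sqrt (4 * B))).subset ?_
  intro x hx
  have hx : c ≤ eval x p * Real.exp (-∑ i, (x i ^ 2 / 2 + a i * x i)) := hx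
  have h1 : c ≤ M * Real.exp (k * ∑ i, |x i|) * Real.exp (-∑ i, (x i ^ 2 / 2 + a i * x i)) :=
    hx.trans (mul_le_mul_of_nonneg_right ((le_abs_self _).trans (h x)) (Real.exp_pos _).le)
  rw [mul_assoc, ← Real.exp_add] at h1
  have hM : 0 < M := by
    by_contra! hM
    nlinarith [Real.exp_pos (k * ∑ i, |x i| + -∑ i, (x i ^ 2 / 2 + a i * x i))]
  have h2 : -(k * ∑ i, |x i| + -∑ i, (x i ^ 2 / 2 + a i * x i)) ≤ Real.log (M / c) := by
    rw [Real.le_log_iff_exp_le (by positivity), Real.exp_neg, le_div_iff₀ hc,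
      inv_mul_le_iff₀ (Real.exp_pos _), mul_comm]
    exact h1
  have h3 : ∑ i, x i ^ 2 / 4 ≤ B := by
    have : ∑ i, (x i ^ 2 / 4 - (k + A) ^ 2) ≤ ∑ i, (x i ^ 2 / 2 + a i * x i - k * |x i|) := by
      refine Finset.sum_le_sum fun i _ => ?_
      have ha : |a i| ≤ A := Finset.single_le_sum (f := fun i => |a i|) (fun _ _ => abs_nonneg _)
            (Finset.mem_univ i)
      have hax : -(A * |x i|) ≤ a i * x i := by
        have := neg_abs_le (a i * x i)
        rw [abs_mul] at this
        nlinarith [abs_nonneg (x i)]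
      nlinarith [sq_abs (x i), sq_nonneg (|x i| / 2 - (k + A))]
    simp only [Finset.sum_sub_distrib, ← Finset.mul_sum] at this
    linarith
  rw [mem_closedBall_zero_iff, pi_norm_le_iff_of_nonneg (Real.sqrt_nonneg _)]
  intro i
  refine Real.abs_le_sqrt ?_
  have := Finset.single_le_sum (f := fun i => x i ^ 2 / 4) (fun _ _ => by positivity)
            (Finset.mem_univ i)
  linarith

theorem MvPolynomial.derivation_apply_aeval {σ R B M : Type*} [Fintype σ] [CommRing R]
    [CommRing B] [Algebra R B] [AddCommGroup M] [Module R M] [Module B M] [IsScalarTower R B M]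
    (D : Derivation R B M) (x : σ → B) (p : MvPolynomial σ R) :
    D (aeval x p) = ∑ j, aeval x (pderiv j p) • D (x j) := by
  classical
  induction p using MvPolynomial.induction_on with
  | C a => simp
  | add p q hp hq => simp [add_smul, Finset.sum_add_distrib, hp, hq]
  | mul_X p i hp =>
    simp [pderiv_X, Pi.single_apply, add_smul, Finset.sum_add_distrib, hp,
      apply_ite, Finset.smul_sum, mul_smul, ite_smul]

/-- A square polynomial system over a field has finitely many nondegenerate zeros. -/
theorem MvPolynomial.finite_nondegenerate_zeros {σ K : Type*} [Fintype σ] [DecidableEq σ] [Field K]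
    (f : σ → MvPolynomial σ K) :
    {x : σ → K | (∀ i, eval x (f i) = 0) ∧
      (Matrix.of fun i j => eval x (pderiv j (f i))).det ≠ 0}.Finite := by
  let J : Matrix σ σ (MvPolynomial σ K) := Matrix.of fun i j => pderiv j (f i)
  let I : Ideal (MvPolynomial σ K) := Ideal.span (Set.range f)
  let C := MvPolynomial σ K ⧸ I
  let B := Localization.Away (Ideal.Quotient.mk I J.det : C)
  let y : σ → B := fun j => algebraMap C B (Ideal.Quotient.mk I (X j))
  have hay : ∀ p : MvPolynomial σ K, aeval y p = algebraMap C B (Ideal.Quotient.mk I p) := by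
    intro p
    have : aeval y = (IsScalarTower.toAlgHom K C B).comp (Ideal.Quotient.mkₐ K I) := by
      ext j; simp [y]; rfl
    rw [this]; rfl
  have hyf : ∀ i, aeval y (f i) = 0 := fun i => by
    rw [hay, Ideal.Quotient.eq_zero_iff_mem.2 (Ideal.subset_span (Set.mem_range_self i)), map_zero]
  have hyJ : IsUnit (aeval y J.det) := by
    rw [hay]
    exact IsLocalization.Away.algebraMap_isUnit _
  have hDy : ∀ j, KaehlerDifferential.D K B (y j) = 0 := by
    intro j
    have hm : ∀ i, ∑ j, aeval y (J i j) • KaehlerDifferential.D K B (y j) = 0 := fun i => by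
      have := derivation_apply_aeval (KaehlerDifferential.D K B) y (f i)
      rw [hyf, map_zero] at this
      exact this.symm
    have hadj : ∑ i, aeval y (J.adjugate j i) •
        ∑ k, aeval y (J i k) • KaehlerDifferential.D K B (y k) = 0 := by simp [hm]
    simp_rw [Finset.smul_sum, smul_smul, ← map_mul] at hadj
    rw [Finset.sum_comm] at hadj
    simp_rw [← Finset.sum_smul, ← map_sum, ← Matrix.mul_apply, Matrix.adjugate_mul] at hadj
    simp [Matrix.one_apply, apply_ite, ite_smul] at hadj
    exact (hyJ.smul_eq_zero).1 hadj
  have hD : ∀ b : B, KaehlerDifferential.D K B b = 0 := by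
    intro b
    obtain ⟨⟨c, s⟩, hb⟩ := IsLocalization.surj (Submonoid.powers (Ideal.Quotient.mk I J.det : C)) b
    have hs : IsUnit (algebraMap C B s) := IsLocalization.map_units B s
    have hz : ∀ c : C, KaehlerDifferential.D K B (algebraMap C B c) = 0 := by
      intro c
      obtain ⟨p, rfl⟩ := Ideal.Quotient.mk_surjective c
      rw [← hay, derivation_apply_aeval]
      simp [hDy]
    have := congrArg (KaehlerDifferential.D K B) hb
    rw [Derivation.leibniz, hz, hz, smul_zero, zero_add] at this
    exact hs.smul_eq_zero.1 this
  have : Algebra.FormallyUnramified K B := by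
    constructor
    rw [← Submodule.subsingleton_iff B, ← subsingleton_iff_bot_eq_top, eq_comm, eq_bot_iff,
      ← KaehlerDifferential.span_range_derivation, Submodule.span_le]
    rintro _ ⟨b, rfl⟩
    simp [hD]
  have : Algebra.FiniteType K B :=
    have : Algebra.FiniteType C B := 
      IsLocalization.finiteType_of_monoid_fg (Submonoid.powers (Ideal.Quotient.mk I J.det : C)) B
    Algebra.FiniteType.trans (S := C) inferInstance inferInstance
  have : Module.Finite K B := Algebra.FormallyUnramified.finite_of_free K B
  refine (Set.finite_range fun (φ : B →ₐ[K] K) (j : σ) => φ (y j)).subset ?_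
  rintro x ⟨hx, hxJ⟩
  let g : C →ₐ[K] K := Ideal.Quotient.liftₐ I (aeval x) (by
    intro a ha
    have : I ≤ RingHom.ker (aeval x : MvPolynomial σ K →ₐ[K] K) := Ideal.span_le.2 (by
      rintro _ ⟨i, rfl⟩
      exact hx i)
    exact this ha)
  have hg : ∀ p, g (Ideal.Quotient.mk I p) = eval x p := fun p => rfl
  have hgJ : ∀ s : Submonoid.powers (Ideal.Quotient.mk I J.det : C), IsUnit (g s) := by
    rintro ⟨_, k, rfl⟩
    rw [map_pow]
    refine IsUnit.pow _ (isUnit_iff_ne_zero.2 ?_)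
    rw [hg, RingHom.map_det]
    exact hxJ
  refine ⟨IsLocalization.liftAlgHom hgJ, ?_⟩
  ext j
  exact (IsLocalization.lift_eq (g := (g : C →+* K)) hgJ _).trans ((hg (X j)).trans (eval_X j))

/-- The critical equations of `p² exp (-∑ (xᵢ² / 2 + aᵢ xᵢ))`, divided by the factor `p`. -/
noncomputable def MvPolynomial.dampedCritical {σ : Type*} (p : MvPolynomial σ ℝ) (a : σ → ℝ)
    (i : σ) :
    MvPolynomial σ ℝ :=
  2 * pderiv i p - p * (X i + C (a i))

theorem MvPolynomial.exists_eval_dampedCritical_eq_zero {σ : Type*} [Fintype σ]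
    (p : MvPolynomial σ ℝ) (a : σ → ℝ) {s : Set (σ → ℝ)} (hs : s.Nonempty) (hso : IsOpen s)
    (hsp : ∀ x ∈ s, eval x p ≠ 0) (hsc : IsOpen ({x | eval x p ≠ 0} \ s)) :
    ∃ x ∈ s, ∀ i, eval x (p.dampedCritical a i) = 0 := by
  classical
  set w : (σ → ℝ) → ℝ := fun x => -∑ i, (x i ^ 2 / 2 + a i * x i)
  set ψ : (σ → ℝ) → ℝ := fun x => eval x (p ^ 2) * Real.exp (w x)
  have hwc : Continuous w := by fun_prop
  have hψc : Continuous ψ := (continuous_eval _).mul hwc.rexp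
  have hψ0 : ∀ x, 0 < ψ x → eval x p ≠ 0 := by
    rintro x hx h
    simp [ψ, h] at hx
  obtain ⟨x₀, hx₀⟩ := hs
  have hpos : 0 < ψ x₀ := by
    have := hsp x₀ hx₀
    simp only [ψ, map_pow]
    positivity
  have hK : IsCompact (s ∩ {x | ψ x₀ ≤ ψ x}) := by
    refine Metric.isCompact_of_isClosed_isBounded ?_
      (((p ^ 2).isBounded_le_eval_mul_exp a hpos).subset Set.inter_subset_right)
    have : s ∩ {x | ψ x₀ ≤ ψ x} = {x | ψ x₀ ≤ ψ x} ∩ ({x | eval x p ≠ 0} \ s)ᶜ := by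
      ext x
      simp only [Set.mem_inter_iff, Set.mem_compl_iff, Set.mem_sdiff, Set.mem_ofPred_eq]
      constructor
      · rintro ⟨h, h'⟩
        exact ⟨h', fun h'' => h''.2 h⟩
      · rintro ⟨h, h'⟩
        exact ⟨by_contra fun hx => h' ⟨hψ0 x (hpos.trans_le h), hx⟩, h⟩
    rw [this]
    exact (isClosed_le continuous_const hψc).inter hsc.isClosed_compl
  obtain ⟨x, ⟨hxs, hxψ⟩, hmax⟩ := hK.exists_isMaxOn ⟨x₀, hx₀, le_refl (ψ x₀)⟩ hψc.continuousOn
  refine ⟨x, hxs, fun i => ?_⟩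
  have hloc : IsLocalMax ψ x := by
    filter_upwards [hso.mem_nhds hxs] with y hy
    by_cases h : ψ x₀ ≤ ψ y
    · exact hmax ⟨hy, h⟩
    · exact (not_le.1 h).le.trans hxψ
  have hline : HasDerivAt (fun t : ℝ => x + t • Pi.single i (1 : ℝ)) (Pi.single i (1 : ℝ)) 0 := by
    simpa using ((hasDerivAt_id (0 : ℝ)).smul_const (Pi.single i (1 : ℝ) : σ → ℝ)).const_add x
  have hp : HasDerivAt (fun t : ℝ => eval (x + t • Pi.single i (1 : ℝ)) p)
      (eval x (pderiv i p)) 0 := by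
    have h := p.hasFDerivAt_eval (x + (0 : ℝ) • Pi.single i (1 : ℝ))
    have := h.comp_hasDerivAt (0 : ℝ) hline
    simpa [Pi.single_apply, Function.comp_def] using this
  have hwd : HasDerivAt (fun t : ℝ => w (x + t • Pi.single i (1 : ℝ))) (-(x i + a i)) 0 := by
    have h : ∀ j, HasDerivAt (fun t : ℝ => (x + t • (Pi.single i (1 : ℝ) : σ → ℝ)) j)
        ((Pi.single i (1 : ℝ) : σ → ℝ) j) 0 := hasDerivAt_pi.1 hline
    have := (HasDerivAt.fun_sum (u := Finset.univ) fun j _ =>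
      (((h j).pow 2).div_const 2).add ((h j).const_mul (a j))).neg
    refine (this.congr_deriv ?_)
    simp [Pi.single_apply, Finset.sum_add_distrib, ite_div]
  have hψd := ((hp.pow 2).mul hwd.exp)
  have hl : IsLocalMax ((fun t : ℝ => eval (x + t • Pi.single i (1 : ℝ)) p) ^ 2 *
      fun t : ℝ => Real.exp (w (x + t • Pi.single i (1 : ℝ)))) 0 := by
    have hc : ContinuousAt (fun t : ℝ => x + t • Pi.single i (1 : ℝ)) 0 := hline.continuousAt
    have := hc.eventually (p := fun y => ψ y ≤ ψ x)
      (by simpa using (show ∀ᶠ y in 𝓝 x, ψ y ≤ ψ x from hloc))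
    filter_upwards [this] with t ht
    simpa [ψ] using ht
  have h0 := hl.hasDerivAt_eq_zero hψd
  have hne := hsp x hxs
  simp at h0
  have h1 : eval x p * Real.exp (w x) * (2 * eval x (pderiv i p) - eval x p * (x i + a i)) = 0 := by
    linear_combination h0
  simpa [dampedCritical, hne] using h1

theorem MvPolynomial.exists_dampedCritical_nondegenerate {σ : Type*} [Fintype σ] [DecidableEq σ]
    (p : MvPolynomial σ ℝ) :
    ∃ a : σ → ℝ, ∀ x, eval x p ≠ 0 → (∀ i, eval x (p.dampedCritical a i) = 0) →
      (Matrix.of fun i j => eval x (pderiv j (p.dampedCritical a i))).det ≠ 0 := by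
  set F : (σ → ℝ) → (σ → ℝ) := fun x i => 2 * eval x (pderiv i p) / eval x p - x i
  set M : (σ → ℝ) → Matrix σ σ ℝ := fun x =>
    Matrix.of fun i j => eval x (pderiv j (p.dampedCritical (F x) i))
  set F' : (σ → ℝ) → (σ → ℝ) →L[ℝ] (σ → ℝ) := fun x =>
    LinearMap.toContinuousLinearMap (Matrix.toLin' ((eval x p)⁻¹ • M x))
  have hd : ∀ x, eval x p ≠ 0 → HasFDerivAt F (F' x) x := by
    intro x hx
    rw [hasFDerivAt_pi']
    intro i
    have h := ((((pderiv i p).hasFDerivAt_eval x).const_mul 2).mul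
      ((hasDerivAt_inv hx).comp_hasFDerivAt x (p.hasFDerivAt_eval x))).sub
      (hasFDerivAt_apply (𝕜 := ℝ) i x)
    refine h.congr_fderiv ?_
    refine ContinuousLinearMap.ext fun v => ?_
    have hMv : (M x *ᵥ v) i = 2 * ∑ j, eval x (pderiv j (pderiv i p)) * v j -
        (x i + F x i) * ∑ j, eval x (pderiv j p) * v j - eval x p * v i := by
      have h2 : ∀ j, eval x (pderiv j (2 : MvPolynomial σ ℝ)) = 0 := fun j => by
        rw [← map_ofNat (C (σ := σ) (R := ℝ)) 2, pderiv_C, map_zero]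
      have hi : ∑ j, (if i = j then (1 : ℝ) else 0) * v j = v i := by simp
      rw [← hi]
      simp only [Finset.mul_sum, ← Finset.sum_sub_distrib]
      refine Finset.sum_congr rfl fun j _ => ?_
      simp only [M, dampedCritical, h2, pderiv_X, Pi.single_apply, Matrix.of_apply, map_sub, map_add,
        pderiv_mul, map_mul, pderiv_C, eval_X, eval_C, add_zero, map_ofNat, zero_mul, zero_add,
        apply_ite (eval x), map_one, map_zero]
      ring
    have hF'v : F' x v i = (eval x p)⁻¹ * (M x *ᵥ v) i := by
      simp [F']
    rw [ContinuousLinearMap.comp_apply, ContinuousLinearMap.proj_apply, hF'v, hMv]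
    simp [F]
    field_simp
    ring
  have hnull : MeasureTheory.volume (F '' {x | eval x p ≠ 0 ∧ (M x).det = 0}) = 0 := by
    refine MeasureTheory.addHaar_image_eq_zero_of_det_fderivWithin_eq_zero _ (f' := F')
      (fun x hx => (hd x hx.1).hasFDerivWithinAt) fun x hx => ?_
    simp only [F', LinearMap.det_toContinuousLinearMap, LinearMap.det_toLin', Matrix.det_smul, hx.2,
      mul_zero]
  obtain ⟨a, ha⟩ : ∃ a, a ∉ F '' {x | eval x p ≠ 0 ∧ (M x).det = 0} := by
    by_contra! h
    rw [Set.eq_univ_of_forall h] at hnull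
    exact isOpen_univ.measure_ne_zero MeasureTheory.volume Set.univ_nonempty hnull
  refine ⟨a, fun x hx hxa hdet => ha ⟨x, ⟨hx, ?_⟩, ?_⟩⟩
  all_goals
    have hFx : F x = a := by
      ext i
      have := hxa i
      simp [dampedCritical] at this
      simp only [F]
      field_simp
      linarith
  · simpa only [M, hFx] using hdet
  · exact hFx

/-- Finitely many points meet every nonempty clopen subset of the complement of a real
hypersurface; in particular this complement has finitely many connected components. -/
theorem MvPolynomial.exists_finite_inter_nonempty_of_isClopen {σ : Type*} [Fintype σ]
    (p : MvPolynomial σ ℝ) :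
    ∃ F : Set (σ → ℝ), F.Finite ∧ ∀ s : Set (σ → ℝ), s.Nonempty → IsOpen s →
      (∀ x ∈ s, eval x p ≠ 0) → IsOpen ({x | eval x p ≠ 0} \ s) → (s ∩ F).Nonempty := by
  classical
  obtain ⟨a, ha⟩ := p.exists_dampedCritical_nondegenerate
  refine ⟨_, finite_nondegenerate_zeros (p.dampedCritical a), fun s hs hso hsp hsc => ?_⟩
  obtain ⟨x, hxs, hx⟩ := p.exists_eval_dampedCritical_eq_zero a hs hso hsp hsc
  exact ⟨x, hxs, hx, ha x (hsp x hxs) hx⟩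

theorem ESSE.symm {S : Set ℝ} {p q : (n : ℕ) × Matrix (Fin n) (Fin n) ℝ} (h : ESSE S p q) :
    ESSE S q p := by
  obtain ⟨R, T, hR, hT, hp, hq⟩ := h
  exact ⟨T, R, hT, hR, hq, hp⟩

theorem SSE.symm {S : Set ℝ} {p q : (n : ℕ) × Matrix (Fin n) (Fin n) ℝ} (h : SSE S p q) :
    SSE S q p :=
  
  have : Std.Symm (ESSE S) := ⟨fun _ _ => ESSE.symm⟩
  Relation.ReflTransGen.stdSymm.symm _ _ h

theorem SSE.trans {S : Set ℝ} {p q r : (n : ℕ) × Matrix (Fin n) (Fin n) ℝ} (h : SSE S p q)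
    (h' : SSE S q r) : SSE S p r :=
  Relation.ReflTransGen.trans h h'

theorem isOpen_setOf_posEntries {m n : ℕ} :
    IsOpen {A : Matrix (Fin m) (Fin n) ℝ | PosEntries A} := by
  simp only [PosEntries, Set.ofPred_forall]
  exact isOpen_iInter_of_finite fun i => isOpen_iInter_of_finite fun j =>
    isOpen_lt continuous_const (by fun_prop)

theorem continuousAt_inv_of_det_ne_zero {n : ℕ} {G : Matrix (Fin n) (Fin n) ℝ} (hG : G.det ≠ 0) :
    ContinuousAt (fun H : Matrix (Fin n) (Fin n) ℝ => H⁻¹) G := by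
  simp only [Matrix.inv_def, Ring.inverse_eq_inv']
  exact ((Continuous.matrix_det continuous_id).continuousAt.inv₀ hG).smul
    (Continuous.matrix_adjugate continuous_id).continuousAt

/-- A positive matrix commutes with some invertible positive `X` such that `X⁻¹ * A` is positive:
take `X = 1 + ε A` with `ε > 0` small. -/
theorem PosEntries.exists_commute {n : ℕ} {A : Matrix (Fin n) (Fin n) ℝ} (hA : PosEntries A) :
    ∃ X : Matrix (Fin n) (Fin n) ℝ, X.det ≠ 0 ∧ Commute X A ∧ PosEntries X ∧
      PosEntries (X⁻¹ * A) := by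
  have hX : Continuous fun ε : ℝ => (1 + ε • A : Matrix (Fin n) (Fin n) ℝ) := by fun_prop
  have h1 : ∀ᶠ ε : ℝ in 𝓝 0, (1 + ε • A).det ≠ 0 :=
    hX.matrix_det.continuousAt.eventually_ne (by simp)
  have h2 : ∀ᶠ ε : ℝ in 𝓝 0, PosEntries ((1 + ε • A)⁻¹ * A) := by
    have hc : ContinuousAt (fun ε : ℝ => (1 + ε • A)⁻¹ * A) 0 :=
      (ContinuousAt.comp (f := fun ε : ℝ => 1 + ε • A) (continuousAt_inv_of_det_ne_zero (by simp))
        hX.continuousAt).mul continuousAt_const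
    exact hc.eventually (isOpen_setOf_posEntries.mem_nhds (by simpa using hA))
  obtain ⟨ε, ⟨hd, hp⟩, hε⟩ := (((h1.and h2).filter_mono nhdsWithin_le_nhds).and
    (self_mem_nhdsWithin (s := Set.Ioi (0 : ℝ)))).exists
  refine ⟨1 + ε • A, hd, (Commute.one_left A).add_left ((Commute.refl A).smul_left ε), ?_, hp⟩
  intro i j
  have hε : 0 < ε := hε
  have := mul_pos hε (hA i j)
  have h0 : 0 ≤ (1 : Matrix (Fin n) (Fin n) ℝ) i j := by
    rw [Matrix.one_apply]; split_ifs <;> norm_num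
  simp only [Matrix.add_apply, Matrix.smul_apply, smul_eq_mul]
  linarith

/-- Conjugating a positive matrix by a matrix near the identity is an elementary strong shift
equivalence over the nonnegative reals. -/
theorem PosEntries.eventually_esse {n : ℕ} {A : Matrix (Fin n) (Fin n) ℝ} (hA : PosEntries A) :
    ∀ᶠ G : Matrix (Fin n) (Fin n) ℝ in 𝓝 1,
      ESSE {x : ℝ | 0 ≤ x} ⟨n, A⟩ ⟨n, G⁻¹ * A * G⟩ := by
  obtain ⟨X, hXd, hXA, hX, hXA'⟩ := hA.exists_commute
  have h0 : ∀ᶠ G : Matrix (Fin n) (Fin n) ℝ in 𝓝 1, G.det ≠ 0 :=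
    (Continuous.matrix_det continuous_id).continuousAt.eventually_ne (by simp)
  have h1 : ∀ᶠ G : Matrix (Fin n) (Fin n) ℝ in 𝓝 1, PosEntries (X * G) :=
    (Continuous.continuousAt (by fun_prop)).eventually
      (isOpen_setOf_posEntries.mem_nhds (by simpa using hX))
  have h2 : ∀ᶠ G : Matrix (Fin n) (Fin n) ℝ in 𝓝 1, PosEntries (G⁻¹ * (X⁻¹ * A)) :=
    ((continuousAt_inv_of_det_ne_zero (by simp)).mul continuousAt_const).eventually
      (isOpen_setOf_posEntries.mem_nhds (by simpa using hXA'))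
  filter_upwards [h0, h1, h2] with G hG hR hS
  have hXu : IsUnit X.det := isUnit_iff_ne_zero.2 hXd
  have hGu : IsUnit G.det := isUnit_iff_ne_zero.2 hG
  refine ⟨X * G, G⁻¹ * (X⁻¹ * A), fun i j => (hR i j).le, fun i j => (hS i j).le, ?_, ?_⟩
  · rw [Matrix.mul_assoc, Matrix.mul_nonsing_inv_cancel_left _ _ hGu,
      Matrix.mul_nonsing_inv_cancel_left _ _ hXu]
  · have : X⁻¹ * A * X = A := by
      rw [Matrix.mul_assoc, ← hXA.eq, Matrix.nonsing_inv_mul_cancel_left _ _ hXu]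
    calc G⁻¹ * A * G = G⁻¹ * (X⁻¹ * A * X) * G := by rw [this]
      _ = _ := by simp only [Matrix.mul_assoc]

/-- Near an invertible `G` with `G⁻¹ * A * G` positive, all conjugates of `A` are strong shift
equivalent. -/
theorem eventually_sse_conj {n : ℕ} {A G : Matrix (Fin n) (Fin n) ℝ} (hG : G.det ≠ 0)
    (hA : PosEntries (G⁻¹ * A * G)) :
    ∀ᶠ H : Matrix (Fin n) (Fin n) ℝ in 𝓝 G,
      SSE {x : ℝ | 0 ≤ x} ⟨n, G⁻¹ * A * G⟩ ⟨n, H⁻¹ * A * H⟩ := by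
  have hGu : IsUnit G.det := isUnit_iff_ne_zero.2 hG
  have hc : Continuous fun H : Matrix (Fin n) (Fin n) ℝ => G⁻¹ * H := by fun_prop
  have := hc.continuousAt (x := G) |>.eventually
    (p := fun H => ESSE {x : ℝ | 0 ≤ x} ⟨n, G⁻¹ * A * G⟩ ⟨n, H⁻¹ * (G⁻¹ * A * G) * H⟩)
    (by simp only [Matrix.nonsing_inv_mul _ hGu]; exact hA.eventually_esse)
  filter_upwards [this] with H hH
  refine Relation.ReflTransGen.single ?_
  convert hH using 2
  rw [Matrix.mul_inv_rev, Matrix.nonsing_inv_nonsing_inv _ hGu]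
  simp only [Matrix.mul_assoc, Matrix.mul_nonsing_inv_cancel_left _ _ hGu]

/-- A polynomial in the entries of `G`, nonvanishing exactly where `G` is invertible and no entry
of `G⁻¹ * A * G` is zero. -/
theorem exists_mvPolynomial_conj_entries {n : ℕ} (A : Matrix (Fin n) (Fin n) ℝ) :
    ∃ p : MvPolynomial (Fin n × Fin n) ℝ, ∀ G : Matrix (Fin n) (Fin n) ℝ,
      eval (fun ij => G ij.1 ij.2) p ≠ 0 ↔ G.det ≠ 0 ∧ ∀ i j, (G⁻¹ * A * G) i j ≠ 0 := by
  set Y := Matrix.mvPolynomialX (Fin n) (Fin n) ℝ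
  set A' : Matrix (Fin n) (Fin n) (MvPolynomial (Fin n × Fin n) ℝ) := A.map C
  refine ⟨Y.det * ∏ i, ∏ j, (Y.adjugate * A' * Y) i j, fun G => ?_⟩
  set e := eval fun ij : Fin n × Fin n => G ij.1 ij.2
  have hY : e.mapMatrix Y = G := by ext i j; simp [Y, e]
  have hA : e.mapMatrix A' = A := by ext i j; simp [A', e]
  have hd : e Y.det = G.det := by rw [RingHom.map_det, hY]
  have hent : ∀ i j, e ((Y.adjugate * A' * Y) i j) = (G.adjugate * A * G) i j := by
    intro i j
    have : e.mapMatrix (Y.adjugate * A' * Y) = G.adjugate * A * G := by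
      rw [map_mul, map_mul, RingHom.map_adjugate, hY, hA]
    rw [← this]; rfl
  simp only [map_mul, map_prod, hd, hent, mul_ne_zero_iff, Finset.prod_ne_zero_iff,
    Finset.mem_univ, true_imp_iff]
  refine and_congr_right fun hG => ?_
  simp [Matrix.inv_def, hG]

/-- The positive `n × n` matrices conjugate over `ℝ` to a given positive matrix `A`
fall into only finitely many strong-shift-equivalence-over-`ℝ₊` classes. -/
theorem finitely_many_sse_classes (n : ℕ) (A : Matrix (Fin n) (Fin n) ℝ)
    (hA : PosEntries A) :
    ∃ F : Finset (Matrix (Fin n) (Fin n) ℝ),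
      (∀ M ∈ F, PosEntries M) ∧
      ∀ B : Matrix (Fin n) (Fin n) ℝ, PosEntries B →
        (∃ G Ginv : Matrix (Fin n) (Fin n) ℝ,
          G * Ginv = 1 ∧ Ginv * G = 1 ∧ B = Ginv * A * G) →
        ∃ M ∈ F, SSE {x : ℝ | 0 ≤ x} ⟨n, B⟩ ⟨n, M⟩ := by
  classical
  obtain ⟨p, hp⟩ := exists_mvPolynomial_conj_entries A
  obtain ⟨F, hF, hFs⟩ := p.exists_finite_inter_nonempty_of_isClopen
  let m : (Fin n × Fin n → ℝ) → Matrix (Fin n) (Fin n) ℝ := fun x => Matrix.of fun i j => x (i, j)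
  let c : (Fin n × Fin n → ℝ) → Matrix (Fin n) (Fin n) ℝ := fun x => (m x)⁻¹ * A * m x
  have hm : Continuous m := by fun_prop
  have hpm : ∀ x, eval x p ≠ 0 ↔ (m x).det ≠ 0 ∧ ∀ i j, c x i j ≠ 0 := fun x => hp (m x)
  have hcc : ∀ x, (m x).det ≠ 0 → ContinuousAt c x := fun x hx =>
    (((continuousAt_inv_of_det_ne_zero hx).comp hm.continuousAt).mul continuousAt_const).mul
      hm.continuousAt
  have hpo : IsOpen {x | eval x p ≠ 0} := isOpen_ne_fun (continuous_eval p) continuous_const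
  refine ⟨(hF.toFinset.image c).filter PosEntries, fun M hM => (Finset.mem_filter.1 hM).2, ?_⟩
  rintro B hB ⟨G, Ginv, hG, hG', rfl⟩
  obtain rfl : G⁻¹ = Ginv := Matrix.inv_eq_right_inv hG
  have hGd : G.det ≠ 0 := fun h => by
    have := congrArg Matrix.det hG
    rw [Matrix.det_mul, h, zero_mul, Matrix.det_one] at this
    exact zero_ne_one this
  set s : Set (Fin n × Fin n → ℝ) := {x | (m x).det ≠ 0 ∧ PosEntries (c x) ∧
    SSE {x : ℝ | 0 ≤ x} ⟨n, G⁻¹ * A * G⟩ ⟨n, c x⟩}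
  have hdet : ∀ x, (m x).det ≠ 0 → ∀ᶠ y in 𝓝 x, (m y).det ≠ 0 := fun x hx =>
    hm.matrix_det.continuousAt.eventually_ne hx
  have hpos : ∀ x, (m x).det ≠ 0 → PosEntries (c x) → ∀ᶠ y in 𝓝 x, PosEntries (c y) :=
    fun x hx h => (hcc x hx).eventually (isOpen_setOf_posEntries.mem_nhds h)
  have hsse : ∀ x, (m x).det ≠ 0 → PosEntries (c x) →
      ∀ᶠ y in 𝓝 x, SSE {x : ℝ | 0 ≤ x} ⟨n, c x⟩ ⟨n, c y⟩ :=
    fun x hx h => hm.continuousAt.eventually (eventually_sse_conj hx h)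
  have hs : IsOpen s := isOpen_iff_eventually.2 fun x ⟨h1, h2, h3⟩ => by
    filter_upwards [hdet x h1, hpos x h1 h2, hsse x h1 h2] with y y1 y2 y3
    exact ⟨y1, y2, h3.trans y3⟩
  have hsc : IsOpen ({x | eval x p ≠ 0} \ s) := isOpen_iff_eventually.2 fun x ⟨hx, hxs⟩ => by
    obtain ⟨h1, h0⟩ := (hpm x).1 hx
    by_cases h2 : PosEntries (c x)
    · filter_upwards [hpo.mem_nhds hx, hsse x h1 h2] with y y1 y2
      exact ⟨y1, fun hy => hxs ⟨h1, h2, hy.2.2.trans y2.symm⟩⟩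
    · simp only [PosEntries, not_forall, not_lt] at h2
      obtain ⟨i, j, hij⟩ := h2
      have hlt : c x i j < 0 := lt_of_le_of_ne hij (h0 i j)
      have hcij : ContinuousAt (fun y => c y i j) x :=
        ((continuous_apply_apply i j).continuousAt).comp (hcc x h1)
      filter_upwards [hpo.mem_nhds hx, hcij.eventually_lt_const hlt] with y y1 y2
      exact ⟨y1, fun hy => (hy.2.1 i j).not_gt y2⟩
  have hGs : (fun ij => G ij.1 ij.2) ∈ s := ⟨hGd, hB, Relation.ReflTransGen.refl⟩
  obtain ⟨x, ⟨hx1, hx2, hx3⟩, hxF⟩ := hFs s ⟨_, hGs⟩ hs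
    (fun x hx => (hpm x).2 ⟨hx.1, fun i j => (hx.2.1 i j).ne'⟩) hsc
  exact ⟨c x, Finset.mem_filter.2 ⟨Finset.mem_image_of_mem c (hF.mem_toFinset.2 hxF), hx2⟩, hx3⟩
end
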